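/- For every cooperative game v on N and every player i ∈ N, the Shapley value is given in terms of the Möbius transform by S(i|v) = ∑_{A ⊆ N, i ∈ A} 𝔪(A)/|A|, where the sum runs over all subsets A of N containing i. -/

import Mathlib

/-- The Shapley value of player `i` in the cooperative game `v` on the finite set `N`:
`S(i|v) = (1/|N|) ∑_{A ⊆ N∖{i}} C(|N|−1, |A|)⁻¹ (v(A∪{i}) − v(A))`. -/
noncomputable def shapley {N : Type*} [Fintype N] [DecidableEq N]
    (v : Finset N → ℝ) (i : N) : ℝ :=
  (Fintype.card N : ℝ)⁻¹ * ∑ A ∈ (Finset.univ.erase i).powerset,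
    ((Nat.choose (Fintype.card N - 1) A.card : ℝ))⁻¹ * (v (insert i A) - v A)

/-- The Möbius transform of a cooperative game: `𝔪(A) = ∑_{B ⊆ A} (−1)^{|A|−|B|} v(B)`. -/
noncomputable def moebius {N : Type*} [DecidableEq N] (v : Finset N → ℝ)
    (A : Finset N) : ℝ :=
  ∑ B ∈ A.powerset, (-1 : ℝ) ^ (A.card - B.card) * v B

open Nat in
theorem shap_key {N : Type*} [DecidableEq N] (C : Finset N) : ∀ b : ℕ,
    ∑ D ∈ C.powerset, (-1 : ℝ) ^ D.card / ((b : ℝ) + D.card + 1)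
      = (b ! : ℝ) * (C.card ! : ℝ) / ((b + C.card + 1)! : ℝ) := by
  induction C using Finset.induction_on with
  | empty =>
    intro b
    have : ((b ! : ℕ) : ℝ) ≠ 0 := by positivity
    have h2 : (b : ℝ) + 1 ≠ 0 := by positivity
    simp [Nat.factorial_succ]
    field_simp
  | insert a C ha ih =>
    intro b
    rw [Finset.sum_powerset_insert ha, ih b]
    have h : ∑ D ∈ C.powerset, (-1 : ℝ) ^ (insert a D).card / ((b : ℝ) + (insert a D).card + 1)
        = - ∑ D ∈ C.powerset, (-1 : ℝ) ^ D.card / (((b + 1 : ℕ) : ℝ) + D.card + 1) := by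
      rw [← Finset.sum_neg_distrib]
      apply Finset.sum_congr rfl
      intro D hD
      have : a ∉ D := fun h => ha (Finset.mem_powerset.1 hD h)
      rw [Finset.card_insert_of_notMem this, pow_succ]
      push_cast
      rw [mul_neg_one, neg_div]
      congr 2
      ring
    rw [h, ih (b + 1), Finset.card_insert_of_notMem ha]
    have e1 : b + 1 + C.card + 1 = (b + C.card + 1) + 1 := by ring
    have e2 : b + (C.card + 1) + 1 = (b + C.card + 1) + 1 := by ring
    rw [e1, e2, Nat.factorial_succ (b + C.card + 1), Nat.factorial_succ b,
      Nat.factorial_succ C.card]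
    have h1 : (((b + C.card + 1)! : ℕ) : ℝ) ≠ 0 := by positivity
    have h2 : (b : ℝ) + C.card + 1 + 1 ≠ 0 := by positivity
    push_cast
    field_simp
    ring

open Nat in
theorem shap_coef {N : Type*} [DecidableEq N] (U B : Finset N) (hB : B ⊆ U) :
    ∑ A ∈ U.powerset with B ⊆ A, (-1 : ℝ) ^ (A.card - B.card) / ((A.card : ℝ) + 1)
      = ((U.card : ℝ) + 1)⁻¹ * ((Nat.choose U.card B.card : ℝ))⁻¹ := by
  have h : ∑ A ∈ U.powerset with B ⊆ A, (-1 : ℝ) ^ (A.card - B.card) / ((A.card : ℝ) + 1)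
      = ∑ D ∈ (U \ B).powerset, (-1 : ℝ) ^ D.card / ((B.card : ℝ) + D.card + 1) := by
    refine Finset.sum_nbij' (fun A => A \ B) (fun D => B ∪ D) ?_ ?_ ?_ ?_ ?_
    · intro A hA
      simp only [Finset.mem_filter, Finset.mem_powerset] at hA ⊢
      exact Finset.sdiff_subset_sdiff hA.1 subset_rfl
    · intro D hD
      simp only [Finset.mem_filter, Finset.mem_powerset] at hD ⊢
      exact ⟨Finset.union_subset hB (hD.trans Finset.sdiff_subset), Finset.subset_union_left⟩
    · intro A hA
      simp only [Finset.mem_filter] at hA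
      exact Finset.union_sdiff_of_subset hA.2
    · intro D hD
      simp only [Finset.mem_powerset] at hD
      exact Finset.union_sdiff_cancel_left (Finset.disjoint_sdiff.mono_right hD)
    · intro A hA
      simp only [Finset.mem_filter] at hA
      have := Finset.card_sdiff_add_card_eq_card hA.2
      rw [← this]
      simp only [Nat.add_sub_cancel]
      push_cast
      rw [add_comm (B.card : ℝ)]
  rw [h, shap_key]
  have := Finset.card_sdiff_add_card_eq_card hB
  rw [← this]
  generalize (U \ B).card = c
  generalize B.card = b
  have hc := Nat.add_choose_mul_factorial_mul_factorial c b
  have hc' : ((c + b).choose b : ℝ) * c ! * b ! = ((c + b)! : ℝ) := by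
    exact_mod_cast hc
  rw [add_comm b c, Nat.factorial_succ]
  push_cast
  rw [← hc']
  have h1 : (b ! : ℝ) ≠ 0 := by positivity
  have h2 : (c ! : ℝ) ≠ 0 := by positivity
  have h3 : ((c + b).choose b : ℝ) ≠ 0 := by
    exact_mod_cast (Nat.choose_pos (Nat.le_add_left b c)).ne'
  have h4 : (c : ℝ) + b + 1 ≠ 0 := by positivity
  field_simp

theorem shap_moebius {N : Type*} [DecidableEq N] (v : Finset N → ℝ) (i : N) (A : Finset N)
    (hi : i ∉ A) : moebius v (insert i A)
      = ∑ B ∈ A.powerset, (-1 : ℝ) ^ (A.card - B.card) * (v (insert i B) - v B) := by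
  unfold moebius
  rw [Finset.sum_powerset_insert hi, ← Finset.sum_add_distrib]
  apply Finset.sum_congr rfl
  intro B hB
  have hBA := Finset.mem_powerset.1 hB
  have hiB : i ∉ B := fun h => hi (hBA h)
  have hle := Finset.card_le_card hBA
  rw [Finset.card_insert_of_notMem hi, Finset.card_insert_of_notMem hiB,
    Nat.add_sub_add_right, Nat.succ_sub hle, pow_succ]
  ring

/-- The Shapley value in terms of the Möbius transform:
`S(i|v) = ∑_{A ∋ i} 𝔪(A)/|A|`. -/
theorem stmt_15 {N : Type*} [Fintype N] [DecidableEq N] [Nonempty N]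
    (v : Finset N → ℝ) (hv : v ∅ = 0) (i : N) :
    shapley v i = ∑ A ∈ Finset.univ.powerset.filter (fun A => i ∈ A),
      moebius v A / A.card := by
  classical
  have hU : (Finset.univ.erase i : Finset N).card + 1 = Fintype.card N := by
    rw [Finset.card_erase_add_one (Finset.mem_univ i), Finset.card_univ]
  have hR : ∑ A ∈ Finset.univ.powerset.filter (fun A => i ∈ A), moebius v A / A.card
      = ∑ A ∈ (Finset.univ.erase i).powerset, moebius v (insert i A) / ((A.card : ℝ) + 1) := by
    refine Finset.sum_nbij' (fun A => A.erase i) (fun A => insert i A) ?_ ?_ ?_ ?_ ?_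
    · intro A _
      exact Finset.mem_powerset.2 (Finset.erase_subset_erase _ (Finset.subset_univ _))
    · intro A _
      simp
    · intro A hA
      exact Finset.insert_erase (Finset.mem_filter.1 hA).2
    · intro A hA
      refine Finset.erase_insert fun h => ?_
      exact Finset.notMem_erase i _ (Finset.mem_powerset.1 hA h)
    · intro A hA
      have h := (Finset.mem_filter.1 hA).2
      rw [Finset.insert_erase h, ← Finset.card_erase_add_one h]
      push_cast
      rfl
  rw [hR]
  unfold shapley
  rw [← hU, Nat.add_sub_cancel]
  generalize hUU : (Finset.univ.erase i : Finset N) = U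
  have hiU : i ∉ U := hUU ▸ Finset.notMem_erase i _
  have h1 : ∀ A ∈ U.powerset, moebius v (insert i A) / ((A.card : ℝ) + 1)
      = ∑ B ∈ U.powerset, if B ⊆ A then
        (-1 : ℝ) ^ (A.card - B.card) / ((A.card : ℝ) + 1) * (v (insert i B) - v B) else 0 := by
    intro A hA
    have hAU := Finset.mem_powerset.1 hA
    rw [shap_moebius v i A (fun h => hiU (hAU h)), Finset.sum_div, ← Finset.sum_filter]
    have : U.powerset.filter (fun B => B ⊆ A) = A.powerset := by
      ext B
      simp only [Finset.mem_filter, Finset.mem_powerset]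
      exact ⟨fun h => h.2, fun h => ⟨h.trans hAU, h⟩⟩
    rw [this]
    apply Finset.sum_congr rfl
    intro B _
    ring
  rw [Finset.sum_congr rfl h1, Finset.sum_comm, Finset.mul_sum]
  apply Finset.sum_congr rfl
  intro B hB
  rw [← Finset.sum_filter, ← Finset.sum_mul, shap_coef U B (Finset.mem_powerset.1 hB)]
  push_cast
  ring
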